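/- Let p > 1, γ, λ, μ ∈ ℝ, and let û₀ : ℝ² → ℂ be measurable with ‖û₀‖_p < ∞. Then there exist T > 0 and a continuous curve v : [0,T] → X_p such that v(0) = û₀ and, for all t ∈ [0,T] and almost every (k,m) ∈ ℝ², v(t)(k,m) = û₀(k,m) e^{i(m² − k²)t} − i ∫₀ᵗ e^{i(k² − m²)(τ − t)} L(v(τ)·e_{2τ})(k,m) dτ, where e_{2τ}(k,m) = e^{2i(k² − m²)τ}. -/

import Mathlib

open MeasureTheory Filter
open scoped ENNReal Topology

/-- The weighted norm `‖v‖_p = (∫ (1 + |k| + |m|)^(2p) |v(k,m)|² dk dm)^(1/2)` on `ℝ²`. -/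
noncomputable def wnorm (p : ℝ) (v : ℝ × ℝ → ℂ) : ℝ≥0∞ :=
  (∫⁻ km : ℝ × ℝ, ENNReal.ofReal ((1 + |km.1| + |km.2|) ^ (2 * p)) * (‖v km‖₊ : ℝ≥0∞) ^ 2) ^
    ((1 : ℝ) / 2)

/-- The convolution `(f ⋆ g)(ξ) = ∫ f (ξ - η) g η dη` over `ℝ²`. -/
noncomputable def conv (f g : ℝ × ℝ → ℂ) : ℝ × ℝ → ℂ :=
  fun ξ => ∫ η : ℝ × ℝ, f (ξ - η) * g η

/-- `v†(k,m) = conj (v (-k, -m))`, the Fourier transform of the complex conjugate. -/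
def dag (v : ℝ × ℝ → ℂ) : ℝ × ℝ → ℂ :=
  fun km => starRingEnd ℂ (v (-km))

/-- `σ(k,m) = k² / (k² + m²)` for `(k,m) ≠ 0`, and `σ(0,0) = 0`. -/
noncomputable def sigmaMul : ℝ × ℝ → ℝ :=
  fun km => if km = 0 then 0 else km.1 ^ 2 / (km.1 ^ 2 + km.2 ^ 2)

/-- The Fourier-side Davey–Stewartson-II nonlinearity
`L(v) = γ (v ⋆ v† ⋆ v) + λμ (v ⋆ (σ · (v ⋆ v†)))`. -/
noncomputable def Lop (γ lam μ : ℝ) (v : ℝ × ℝ → ℂ) : ℝ × ℝ → ℂ :=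
  fun km => (γ : ℂ) * conv (conv v (dag v)) v km +
    ((lam * μ : ℝ) : ℂ) * conv v (fun η => (sigmaMul η : ℂ) * conv v (dag v) η) km

/-- `e_{2τ}(k,m) = e^{2i(k² - m²)τ}`. -/
noncomputable def phase2 (τ : ℝ) (km : ℝ × ℝ) : ℂ :=
  Complex.exp (2 * Complex.I * (((km.1 ^ 2 - km.2 ^ 2) * τ : ℝ) : ℂ))

/-- The Duhamel (mild-solution) integral operator
`(Av)(t)(k,m) = û₀(k,m) e^{i(m² - k²)t}
  - i ∫₀ᵗ e^{i(k² - m²)(τ - t)} L(v(τ)·e_{2τ})(k,m) dτ`. -/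
noncomputable def duhamel (γ lam μ : ℝ) (u0 : ℝ × ℝ → ℂ) (v : ℝ → ℝ × ℝ → ℂ) (t : ℝ) :
    ℝ × ℝ → ℂ :=
  fun km => u0 km * Complex.exp (Complex.I * (((km.2 ^ 2 - km.1 ^ 2) * t : ℝ) : ℂ)) -
    Complex.I * ∫ τ in (0:ℝ)..t,
      Complex.exp (Complex.I * (((km.1 ^ 2 - km.2 ^ 2) * (τ - t) : ℝ) : ℂ)) *
        Lop γ lam μ (fun km' => v τ km' * phase2 τ km') km

/-- A curve `v : [0,T] → X_p`: measurable values, continuous with respect to `‖·‖_p`. -/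
def ContCurve (p T : ℝ) (v : ℝ → ℝ × ℝ → ℂ) : Prop :=
  (∀ t ∈ Set.Icc (0 : ℝ) T, Measurable (v t)) ∧
  ∀ t₀ ∈ Set.Icc (0 : ℝ) T,
    Tendsto (fun t => wnorm p (v t - v t₀)) (𝓝[Set.Icc (0 : ℝ) T] t₀) (𝓝 0)

section Abstract

variable {E F G : Type*} [NormedAddCommGroup E] [NormedAddCommGroup F] [NormedAddCommGroup G]

/-- Lipschitz continuity on every ball around the origin. -/
def LipschitzOnBalls (f : E → F) : Prop :=
  ∀ R : ℝ, ∃ K : NNReal, LipschitzOnWith K f (Metric.closedBall 0 R)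

lemma LipschitzOnBalls.exists_bound {f : E → F} (hf : LipschitzOnBalls f) (R : ℝ) :
    ∃ M : NNReal, ∀ x, ‖x‖ ≤ R → ‖f x‖ ≤ M := by
  obtain ⟨K, hK⟩ := hf R
  refine ⟨⟨K * |R| + ‖f 0‖, by positivity⟩, fun x hx => ?_⟩
  have hR : 0 ≤ R := (norm_nonneg x).trans hx
  have h := hK.norm_sub_le (x := x) (y := 0) (by simpa using hx) (by simpa using hR)
  change ‖f x‖ ≤ K * |R| + ‖f 0‖
  calc ‖f x‖ ≤ ‖f x - f 0‖ + ‖f 0‖ := by simpa using norm_add_le (f x - f 0) (f 0)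
    _ ≤ K * |R| + ‖f 0‖ := by
      gcongr
      refine h.trans ?_
      rw [sub_zero]
      gcongr
      exact hx.trans (le_abs_self R)

lemma LipschitzOnBalls.continuous {f : E → F} (hf : LipschitzOnBalls f) : Continuous f := by
  rw [continuous_iff_continuousAt]
  intro x
  obtain ⟨K, hK⟩ := hf (‖x‖ + 1)
  refine hK.continuousOn.continuousAt (Metric.closedBall_mem_nhds_of_mem ?_)
  simp

lemma LipschitzOnBalls.add {f g : E → F} (hf : LipschitzOnBalls f) (hg : LipschitzOnBalls g) :
    LipschitzOnBalls fun x => f x + g x := fun R => by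
  obtain ⟨K, hK⟩ := hf R
  obtain ⟨K', hK'⟩ := hg R
  exact ⟨_, hK.add hK'⟩

lemma lipschitzOnBalls_id : LipschitzOnBalls fun x : E => x := fun _ =>
  ⟨1, LipschitzWith.id.lipschitzOnWith⟩

variable [NormedSpace ℝ F] [NormedSpace ℝ G]

lemma LipschitzOnBalls.clm_comp {f : E → F} (hf : LipschitzOnBalls f) (A : F →L[ℝ] G) :
    LipschitzOnBalls fun x => A (f x) := fun R => by
  obtain ⟨K, hK⟩ := hf R
  exact ⟨_, A.lipschitz.comp_lipschitzOnWith hK⟩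

lemma LipschitzOnBalls.const_smul {f : E → F} (hf : LipschitzOnBalls f) (c : ℝ) :
    LipschitzOnBalls fun x => c • f x := by
  simpa using hf.clm_comp (c • ContinuousLinearMap.id ℝ F)

variable [NormedSpace ℝ E]

lemma LipschitzOnBalls.bilin {H : Type*} [NormedAddCommGroup H] {f : H → E}
    {g : H → F} (hf : LipschitzOnBalls f) (hg : LipschitzOnBalls g) (B : E →L[ℝ] F →L[ℝ] G) :
    LipschitzOnBalls fun x => B (f x) (g x) := fun R => by
  obtain ⟨K, hK⟩ := hf R
  obtain ⟨K', hK'⟩ := hg R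
  obtain ⟨M, hM⟩ := hf.exists_bound R
  obtain ⟨M', hM'⟩ := hg.exists_bound R
  refine ⟨‖B‖₊ * K * M' + ‖B‖₊ * M * K', LipschitzOnWith.of_dist_le_mul fun x hx y hy => ?_⟩
  have hx' : ‖x‖ ≤ R := by simpa using hx
  have hy' : ‖y‖ ≤ R := by simpa using hy
  rw [dist_eq_norm, dist_eq_norm]
  calc ‖B (f x) (g x) - B (f y) (g y)‖
      = ‖B (f x - f y) (g x) + B (f y) (g x - g y)‖ := by simp
    _ ≤ ‖B‖ * ‖f x - f y‖ * ‖g x‖ + ‖B‖ * ‖f y‖ * ‖g x - g y‖ :=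
        (norm_add_le _ _).trans (add_le_add (B.le_opNorm₂ _ _) (B.le_opNorm₂ _ _))
    _ ≤ ‖B‖ * (K * ‖x - y‖) * M' + ‖B‖ * M * (K' * ‖x - y‖) := by
        gcongr
        · exact hK.norm_sub_le hx hy
        · exact hM' x hx'
        · exact hM y hy'
        · exact hK'.norm_sub_le hx hy
    _ = _ := by push_cast; ring

/-- A strongly continuous family of linear isometries is jointly continuous. -/
lemma continuous_uncurry_of_norm_eq {X : Type*} [TopologicalSpace X] (U : X → E →L[ℝ] E)
    (hU : ∀ t x, ‖U t x‖ = ‖x‖) (hc : ∀ x, Continuous fun t => U t x) :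
    Continuous fun q : X × E => U q.1 q.2 := by
  rw [continuous_iff_continuousAt]
  rintro ⟨s, x⟩
  rw [ContinuousAt, tendsto_iff_norm_sub_tendsto_zero]
  have hc' : Continuous fun q : X × E => ‖q.2 - x‖ + ‖U q.1 x - U s x‖ := by
    have h : Continuous fun q : X × E => U q.1 x := (hc x).comp continuous_fst
    fun_prop
  refine squeeze_zero (fun _ => norm_nonneg _) (fun q => ?_)
    (hc'.tendsto' (s, x) 0 (by simp))
  calc ‖U q.1 q.2 - U s x‖ = ‖U q.1 (q.2 - x) + (U q.1 x - U s x)‖ := by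
        rw [map_sub]; abel_nf
    _ ≤ _ := (norm_add_le _ _).trans_eq (by rw [hU])

/-- Local solvability of `w(t) = x₀ + ∫₀ᵗ U(τ) N(U(τ) w(τ)) dτ` for a strongly continuous family of
linear isometries `U` and a nonlinearity `N` that is Lipschitz on balls. -/
theorem exists_continuous_eq_integral [CompleteSpace E] (U : ℝ → E →L[ℝ] E)
    (hU : ∀ t x, ‖U t x‖ = ‖x‖) (hc : ∀ x, Continuous fun t => U t x) {N : E → E}
    (hN : LipschitzOnBalls N) (x₀ : E) :
    ∃ T : ℝ, 0 < T ∧ ∃ w : ℝ → E, Continuous w ∧ w 0 = x₀ ∧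
      ∀ t ∈ Set.Icc 0 T, w t = x₀ + ∫ τ in (0 : ℝ)..t, U τ (N (U τ (w τ))) := by
  have hball : ∀ x ∈ Metric.closedBall x₀ 1, ‖x‖ ≤ ‖x₀‖ + 1 := fun x hx => by
    have h := norm_le_norm_add_norm_sub' x x₀
    rw [mem_closedBall_iff_norm] at hx
    linarith
  obtain ⟨K, hK⟩ := hN (‖x₀‖ + 1)
  obtain ⟨M, hM⟩ := hN.exists_bound (‖x₀‖ + 1)
  have hT : (0 : ℝ) < 1 / (M + 1) := by positivity
  have hjoint := continuous_uncurry_of_norm_eq U hU hc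
  have hpl : IsPicardLindelof (fun t x => U t (N (U t x))) (tmin := 0) (tmax := 1 / (M + 1))
      ⟨0, Set.left_mem_Icc.2 hT.le⟩ x₀ 1 0 M K :=
    { lipschitzOnWith := fun t _ => LipschitzOnWith.of_dist_le_mul fun x hx y hy => by
        rw [dist_eq_norm, ← map_sub, hU, dist_eq_norm]
        refine (hK.norm_sub_le ?_ ?_).trans_eq ?_
        · simpa [hU] using hball x hx
        · simpa [hU] using hball y hy
        · rw [← map_sub, hU]
      continuousOn := fun x _ => Continuous.continuousOn <|
        hjoint.comp (continuous_id.prodMk (hN.continuous.comp (hc x)))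
      norm_le := fun t _ x hx => by
        rw [hU]
        exact hM _ (by simpa [hU] using hball x hx)
      mul_max_le := by
        have : (M : ℝ) * (1 / (M + 1)) ≤ 1 := by
          rw [mul_one_div, div_le_one (by positivity)]
          linarith
        simp only [sub_zero, sub_self, max_eq_left hT.le]
        simpa using this }
  have hx₀ : x₀ ∈ Metric.closedBall x₀ (0 : NNReal) := by simp
  obtain ⟨α, hα⟩ := ODE.FunSpace.exists_isFixedPt_next hpl hx₀
  have key : ∀ t ∈ Set.Icc (0 : ℝ) (1 / (M + 1)), α.compProj t =
      x₀ + ∫ τ in (0 : ℝ)..t, U τ (N (U τ (α.compProj τ))) := fun t ht => by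
    rw [ODE.FunSpace.compProj_of_mem ht]
    conv_lhs => rw [← hα]
    rfl
  refine ⟨1 / (M + 1), hT, α.compProj, α.continuous_compProj, ?_, key⟩
  simpa using key 0 (Set.left_mem_Icc.2 hT.le)

end Abstract

/-- The squared weight `(1 + |k| + |m|)^(2p)` of `wnorm`. -/
noncomputable def weight (p : ℝ) (x : ℝ × ℝ) : ℝ≥0∞ :=
  ENNReal.ofReal ((1 + |x.1| + |x.2|) ^ (2 * p))

lemma measurable_weight (p : ℝ) : Measurable (weight p) := by
  unfold weight
  fun_prop

lemma weight_ne_top (p : ℝ) (x : ℝ × ℝ) : weight p x ≠ ⊤ := ENNReal.ofReal_ne_top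

lemma one_le_weight {p : ℝ} (hp : 0 ≤ p) (x : ℝ × ℝ) : 1 ≤ weight p x := by
  rw [weight, ENNReal.one_le_ofReal]
  exact Real.one_le_rpow (by linarith [abs_nonneg x.1, abs_nonneg x.2]) (by linarith)

lemma weight_ne_zero (p : ℝ) (x : ℝ × ℝ) : weight p x ≠ 0 := by
  rw [weight, Ne, ENNReal.ofReal_eq_zero, not_le]
  positivity

lemma weight_le {p : ℝ} (hp : 0 ≤ p) (x y : ℝ × ℝ) :
    weight p x ≤ ENNReal.ofReal (2 ^ (2 * p)) * (weight p (x - y) + weight p y) := by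
  unfold weight
  rw [← ENNReal.ofReal_add (by positivity) (by positivity), ← ENNReal.ofReal_mul (by positivity)]
  apply ENNReal.ofReal_le_ofReal
  set a := 1 + |(x - y).1| + |(x - y).2| with ha
  set b := 1 + |y.1| + |y.2| with hb
  have ha0 : 0 < a := by positivity
  have hb0 : 0 < b := by positivity
  have h : 1 + |x.1| + |x.2| ≤ 2 * max a b := by
    have h1 : |x.1| ≤ |(x - y).1| + |y.1| := by
      simpa using abs_add_le (x.1 - y.1) y.1
    have h2 : |x.2| ≤ |(x - y).2| + |y.2| := by
      simpa using abs_add_le (x.2 - y.2) y.2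
    linarith [le_max_left a b, le_max_right a b]
  calc (1 + |x.1| + |x.2|) ^ (2 * p) ≤ (2 * max a b) ^ (2 * p) :=
        Real.rpow_le_rpow (by positivity) h (by linarith)
    _ = 2 ^ (2 * p) * (max a b) ^ (2 * p) := Real.mul_rpow (by norm_num) (by positivity)
    _ ≤ _ := by
        gcongr
        rcases max_choice a b with h | h <;> rw [h] <;>
          linarith [Real.rpow_pos_of_pos ha0 (2 * p), Real.rpow_pos_of_pos hb0 (2 * p)]

lemma lintegral_weight_inv_lt_top {p : ℝ} (hp : 1 < p) :
    ∫⁻ x : ℝ × ℝ, (weight p x)⁻¹ < ⊤ := by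
  have hfin : (Module.finrank ℝ (ℝ × ℝ) : ℝ) < 2 * p := by
    simp; linarith
  refine lt_of_le_of_lt (lintegral_mono fun x => ?_)
    (finite_integral_one_add_norm (μ := (volume : Measure (ℝ × ℝ))) hfin)
  have hx : ‖x‖ ≤ |x.1| + |x.2| := by
    rw [Prod.norm_def]
    exact max_le (by simp) (by simp)
  unfold weight
  rw [← ENNReal.ofReal_inv_of_pos (by positivity), ← Real.rpow_neg (by positivity)]
  exact ENNReal.ofReal_le_ofReal
    (Real.rpow_le_rpow_of_nonpos (by positivity) (by linarith) (by linarith))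

/-- Cauchy–Schwarz for lower integrals, in squared form. -/
lemma sq_lintegral_mul_le {α : Type*} [MeasurableSpace α] (μ : Measure α) {f g : α → ℝ≥0∞}
    (hf : AEMeasurable f μ) (hg : AEMeasurable g μ) :
    (∫⁻ a, f a * g a ∂μ) ^ 2 ≤ (∫⁻ a, f a ^ 2 ∂μ) * ∫⁻ a, g a ^ 2 ∂μ := by
  have h := ENNReal.lintegral_mul_le_Lp_mul_Lq μ Real.HolderConjugate.two_two hf hg
  have hs : ∀ x : ℝ≥0∞, (x ^ (1 / 2 : ℝ)) ^ 2 = x := fun x => by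
    rw [← ENNReal.rpow_natCast, ← ENNReal.rpow_mul]; norm_num
  calc (∫⁻ a, f a * g a ∂μ) ^ 2
      ≤ ((∫⁻ a, f a ^ (2 : ℝ) ∂μ) ^ (1 / 2 : ℝ) * (∫⁻ a, g a ^ (2 : ℝ) ∂μ) ^ (1 / 2 : ℝ)) ^ 2 := by
        gcongr; exact h
    _ = _ := by rw [mul_pow, hs, hs]; simp

lemma sq_lintegral_conv_le {p : ℝ} (hp : 0 ≤ p) {F G : ℝ × ℝ → ℝ≥0∞} (hF : Measurable F)
    (hG : Measurable G) (x : ℝ × ℝ) :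
    (∫⁻ y, F (x - y) * G y) ^ 2 ≤
      (∫⁻ y, weight p y * F y ^ 2) * ∫⁻ y, weight p y * G y ^ 2 := by
  have key : ∀ H : ℝ × ℝ → ℝ≥0∞, ∫⁻ y, H y ^ 2 ≤ ∫⁻ y, weight p y * H y ^ 2 := fun H =>
    lintegral_mono fun y => le_mul_of_one_le_left' (one_le_weight hp y)
  calc (∫⁻ y, F (x - y) * G y) ^ 2 ≤ (∫⁻ y, F (x - y) ^ 2) * ∫⁻ y, G y ^ 2 :=
        sq_lintegral_mul_le _ (by fun_prop) (by fun_prop)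
    _ = (∫⁻ y, F y ^ 2) * ∫⁻ y, G y ^ 2 := by
        rw [lintegral_sub_left_eq_self (fun y => F y ^ 2) x]
    _ ≤ _ := mul_le_mul' (key F) (key G)

/-- The constant in the algebra property of the weighted space. -/
noncomputable def convConst (p : ℝ) : ℝ≥0∞ :=
  ENNReal.ofReal (2 ^ (2 * p)) * (2 * ∫⁻ x : ℝ × ℝ, (weight p x)⁻¹)

lemma convConst_lt_top {p : ℝ} (hp : 1 < p) : convConst p < ⊤ :=
  ENNReal.mul_lt_top ENNReal.ofReal_lt_top
    (ENNReal.mul_lt_top (by norm_num) (lintegral_weight_inv_lt_top hp))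

lemma lintegral_weight_mul_inv_le {p : ℝ} (hp : 0 ≤ p) (x : ℝ × ℝ) :
    weight p x * ∫⁻ y, (weight p (x - y))⁻¹ * (weight p y)⁻¹ ≤ convConst p := by
  have hm := measurable_weight p
  have hm' : Measurable fun y => weight p (x - y) := by fun_prop
  rw [← lintegral_const_mul _ (by fun_prop)]
  calc ∫⁻ y, weight p x * ((weight p (x - y))⁻¹ * (weight p y)⁻¹)
      ≤ ∫⁻ y, ENNReal.ofReal (2 ^ (2 * p)) * ((weight p y)⁻¹ + (weight p (x - y))⁻¹) := by
        refine lintegral_mono fun y => ?_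
        refine (mul_le_mul' (weight_le hp x y) le_rfl).trans (le_of_eq ?_)
        have h1 := ENNReal.mul_inv_cancel (weight_ne_zero p (x - y)) (weight_ne_top p (x - y))
        have h2 := ENNReal.mul_inv_cancel (weight_ne_zero p y) (weight_ne_top p y)
        calc ENNReal.ofReal (2 ^ (2 * p)) * (weight p (x - y) + weight p y) *
              ((weight p (x - y))⁻¹ * (weight p y)⁻¹)
            = ENNReal.ofReal (2 ^ (2 * p)) *
              ((weight p (x - y) * (weight p (x - y))⁻¹) * (weight p y)⁻¹ +
                (weight p y * (weight p y)⁻¹) * (weight p (x - y))⁻¹) := by ring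
          _ = _ := by rw [h1, h2, one_mul, one_mul]
    _ = convConst p := by
        rw [lintegral_const_mul _ (by fun_prop), lintegral_add_left (by fun_prop),
          lintegral_sub_left_eq_self (fun y => (weight p y)⁻¹) x, ← two_mul, convConst]

lemma lintegral_weight_mul_sq_conv_le {p : ℝ} (hp : 0 ≤ p) {F G : ℝ × ℝ → ℝ≥0∞}
    (hF : Measurable F) (hG : Measurable G) :
    ∫⁻ x, weight p x * (∫⁻ y, F (x - y) * G y) ^ 2 ≤
      convConst p * ((∫⁻ y, weight p y * F y ^ 2) * ∫⁻ y, weight p y * G y ^ 2) := by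
  have hm := measurable_weight p
  set W : ℝ × ℝ → ℝ≥0∞ := fun x => weight p x ^ (1 / 2 : ℝ) with hW
  have hWm : Measurable W := by fun_prop
  have hW2 : ∀ x, W x ^ 2 = weight p x := fun x => by
    rw [hW, ← ENNReal.rpow_natCast, ← ENNReal.rpow_mul]; norm_num
  have hW0 : ∀ x, W x ≠ 0 := fun x h => weight_ne_zero p x (by rw [← hW2, h]; simp)
  have hWt : ∀ x, W x ≠ ⊤ := fun x h => weight_ne_top p x (by rw [← hW2, h]; simp)
  have step : ∀ x, weight p x * (∫⁻ y, F (x - y) * G y) ^ 2 ≤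
      convConst p * ∫⁻ y, (weight p (x - y) * F (x - y) ^ 2) * (weight p y * G y ^ 2) := by
    intro x
    have hsplit : ∀ y, F (x - y) * G y =
        (W (x - y) * F (x - y) * (W y * G y)) * ((W (x - y))⁻¹ * (W y)⁻¹) := fun y => by
      calc F (x - y) * G y = (W (x - y) * (W (x - y))⁻¹) * (W y * (W y)⁻¹) * (F (x - y) * G y) := by
            rw [ENNReal.mul_inv_cancel (hW0 _) (hWt _), ENNReal.mul_inv_cancel (hW0 _) (hWt _)]
            simp
        _ = _ := by ring
    have hcs := sq_lintegral_mul_le volume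
      (f := fun y => W (x - y) * F (x - y) * (W y * G y))
      (g := fun y => (W (x - y))⁻¹ * (W y)⁻¹) (by fun_prop) (by fun_prop)
    have e1 : ∀ y, (W (x - y) * F (x - y) * (W y * G y)) ^ 2 =
        (weight p (x - y) * F (x - y) ^ 2) * (weight p y * G y ^ 2) := fun y => by
      rw [← hW2, ← hW2]; ring
    have e2 : ∀ y, ((W (x - y))⁻¹ * (W y)⁻¹) ^ 2 = (weight p (x - y))⁻¹ * (weight p y)⁻¹ :=
      fun y => by rw [mul_pow, ← ENNReal.inv_pow, ← ENNReal.inv_pow, hW2, hW2]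
    simp only [e1, e2] at hcs
    simp only [hsplit]
    calc _ ≤ weight p x * _ := mul_le_mul' le_rfl hcs
      _ = (weight p x * ∫⁻ y, (weight p (x - y))⁻¹ * (weight p y)⁻¹) * _ := by ring
      _ ≤ _ := mul_le_mul' (lintegral_weight_mul_inv_le hp x) le_rfl
  calc _ ≤ ∫⁻ x, convConst p *
        ∫⁻ y, (weight p (x - y) * F (x - y) ^ 2) * (weight p y * G y ^ 2) := lintegral_mono step
    _ = convConst p *
        ∫⁻ x, ∫⁻ y, (weight p (x - y) * F (x - y) ^ 2) * (weight p y * G y ^ 2) :=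
        lintegral_const_mul _ (Measurable.lintegral_prod_right (by fun_prop))
    _ = convConst p *
        ∫⁻ y, ∫⁻ x, (weight p (x - y) * F (x - y) ^ 2) * (weight p y * G y ^ 2) := by
        rw [lintegral_lintegral_swap (Measurable.aemeasurable (by fun_prop))]
    _ = _ := by
        congr 1
        rw [← lintegral_const_mul _ (by fun_prop)]
        refine lintegral_congr fun y => ?_
        rw [lintegral_mul_const _ (by fun_prop),
          lintegral_sub_right_eq_self (fun x => weight p x * F x ^ 2) y]

/-- The measure `(1 + |k| + |m|)^(2p) dk dm`, whose `L²` space is the weighted space. -/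
noncomputable def weightedVolume (p : ℝ) : Measure (ℝ × ℝ) := volume.withDensity (weight p)

instance (p : ℝ) : SigmaFinite (weightedVolume p) :=
  SigmaFinite.withDensity_of_ne_top' (weight_ne_top p)

lemma ae_eq_weightedVolume {p : ℝ} {f g : ℝ × ℝ → ℂ} :
    f =ᵐ[weightedVolume p] g ↔ f =ᵐ[volume] g :=
  withDensity_ae_eq (measurable_weight p).aemeasurable (.of_forall (weight_ne_zero p))

lemma eLpNorm_weightedVolume (p : ℝ) (f : ℝ × ℝ → ℂ) :
    eLpNorm f 2 (weightedVolume p) = wnorm p f := by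
  rw [eLpNorm_eq_lintegral_rpow_enorm_toReal (by norm_num) (by norm_num), weightedVolume,
    lintegral_withDensity_eq_lintegral_mul_non_measurable _ (measurable_weight p)
      (.of_forall fun x => (weight_ne_top p x).lt_top), wnorm]
  simp [weight, enorm]

lemma sq_eLpNorm_weightedVolume (p : ℝ) (f : ℝ × ℝ → ℂ) :
    eLpNorm f 2 (weightedVolume p) ^ 2 = ∫⁻ x, weight p x * ‖f x‖ₑ ^ 2 := by
  rw [eLpNorm_weightedVolume, wnorm, ← ENNReal.rpow_natCast, ← ENNReal.rpow_mul]
  simp [weight, enorm]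

lemma lintegral_enorm_conv_le {p : ℝ} (hp : 0 ≤ p) {f g : ℝ × ℝ → ℂ} (hf : Measurable f)
    (hg : Measurable g) (x : ℝ × ℝ) :
    ∫⁻ y, ‖f (x - y) * g y‖ₑ ≤
      eLpNorm f 2 (weightedVolume p) * eLpNorm g 2 (weightedVolume p) := by
  rw [← ENNReal.pow_le_pow_left_iff two_ne_zero, mul_pow, sq_eLpNorm_weightedVolume,
    sq_eLpNorm_weightedVolume]
  simp only [enorm_mul]
  exact sq_lintegral_conv_le hp hf.enorm hg.enorm x

lemma enorm_conv_le {p : ℝ} (hp : 0 ≤ p) {f g : ℝ × ℝ → ℂ} (hf : Measurable f)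
    (hg : Measurable g) (x : ℝ × ℝ) :
    ‖conv f g x‖ₑ ≤ eLpNorm f 2 (weightedVolume p) * eLpNorm g 2 (weightedVolume p) :=
  (enorm_integral_le_lintegral_enorm _).trans (lintegral_enorm_conv_le hp hf hg x)

lemma integrable_conv {p : ℝ} (hp : 0 ≤ p) {f g : ℝ × ℝ → ℂ} (hf : Measurable f)
    (hg : Measurable g) (hf2 : MemLp f 2 (weightedVolume p)) (hg2 : MemLp g 2 (weightedVolume p))
    (x : ℝ × ℝ) : Integrable fun y => f (x - y) * g y :=
  ⟨Measurable.aestronglyMeasurable (by fun_prop), (lintegral_enorm_conv_le hp hf hg x).trans_lt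
    (ENNReal.mul_lt_top hf2.2 hg2.2)⟩

lemma measurable_conv {f g : ℝ × ℝ → ℂ} (hf : Measurable f) (hg : Measurable g) :
    Measurable (conv f g) := by
  have h : Measurable fun q : (ℝ × ℝ) × (ℝ × ℝ) => f (q.1 - q.2) * g q.2 := by fun_prop
  exact h.stronglyMeasurable.integral_prod_right.measurable

lemma eLpNorm_conv_le {p : ℝ} (hp : 0 ≤ p) {f g : ℝ × ℝ → ℂ} (hf : Measurable f)
    (hg : Measurable g) :
    eLpNorm (conv f g) 2 (weightedVolume p) ≤ convConst p ^ (1 / 2 : ℝ) *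
      (eLpNorm f 2 (weightedVolume p) * eLpNorm g 2 (weightedVolume p)) := by
  have hs : (convConst p ^ (1 / 2 : ℝ)) ^ 2 = convConst p := by
    rw [← ENNReal.rpow_natCast, ← ENNReal.rpow_mul]; norm_num
  rw [← ENNReal.pow_le_pow_left_iff two_ne_zero, mul_pow, mul_pow, hs,
    sq_eLpNorm_weightedVolume, sq_eLpNorm_weightedVolume, sq_eLpNorm_weightedVolume]
  refine le_trans (lintegral_mono fun x => ?_)
    (lintegral_weight_mul_sq_conv_le hp hf.enorm hg.enorm)
  gcongr
  refine (enorm_integral_le_lintegral_enorm _).trans (le_of_eq ?_)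
  simp only [enorm_mul]

lemma memLp_conv {p : ℝ} (hp : 1 < p) {f g : ℝ × ℝ → ℂ} (hf : Measurable f)
    (hg : Measurable g) (hf2 : MemLp f 2 (weightedVolume p))
    (hg2 : MemLp g 2 (weightedVolume p)) : MemLp (conv f g) 2 (weightedVolume p) :=
  ⟨(measurable_conv hf hg).aestronglyMeasurable, (eLpNorm_conv_le (by linarith) hf hg).trans_lt
    (ENNReal.mul_lt_top (ENNReal.rpow_lt_top_of_nonneg (by norm_num) (convConst_lt_top hp).ne)
      (ENNReal.mul_lt_top hf2.2 hg2.2))⟩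

lemma conv_congr {f f' g g' : ℝ × ℝ → ℂ} (hf : f =ᵐ[volume] f') (hg : g =ᵐ[volume] g') :
    conv f g = conv f' g' := by
  funext x
  refine integral_congr_ae ?_
  have := (Measure.measurePreserving_sub_left volume x).quasiMeasurePreserving.ae_eq_comp hf
  filter_upwards [this, hg] with y h1 h2
  simp only [Function.comp_apply] at h1
  rw [h1, h2]

lemma dag_congr {f g : ℝ × ℝ → ℂ} (h : f =ᵐ[volume] g) : dag f =ᵐ[volume] dag g := by
  have := (Measure.measurePreserving_neg
    (volume : Measure (ℝ × ℝ))).quasiMeasurePreserving.ae_eq_comp h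
  filter_upwards [this] with x hx
  simp only [Function.comp_apply] at hx
  simp only [dag, hx]

/-- The weighted space `X_p` modulo a.e. equality. -/
noncomputable abbrev WeightedL2 (p : ℝ) := Lp ℂ 2 (weightedVolume p)

namespace WeightedL2

variable {p : ℝ}

lemma measurable_coe (f : WeightedL2 p) : Measurable f := (Lp.stronglyMeasurable f).measurable

lemma toReal_eLpNorm (f : WeightedL2 p) : (eLpNorm f 2 (weightedVolume p)).toReal = ‖f‖ :=
  (Lp.norm_def f).symm

lemma integrable_conv (hp : 1 < p) (f g : WeightedL2 p) (x : ℝ × ℝ) :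
    Integrable fun y => f (x - y) * g y :=
  _root_.integrable_conv (by linarith) (measurable_coe f) (measurable_coe g) (Lp.memLp f)
    (Lp.memLp g) x

lemma conv_add_left (hp : 1 < p) (f f' g : WeightedL2 p) (x : ℝ × ℝ) :
    conv (f + f' : WeightedL2 p) g x = conv f g x + conv f' g x := by
  rw [conv_congr (ae_eq_weightedVolume.1 (Lp.coeFn_add f f')) (ae_eq_refl _)]
  simp only [conv, Pi.add_apply, add_mul]
  exact integral_add (integrable_conv hp f g x) (integrable_conv hp f' g x)

lemma conv_add_right (hp : 1 < p) (f g g' : WeightedL2 p) (x : ℝ × ℝ) :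
    conv f (g + g' : WeightedL2 p) x = conv f g x + conv f g' x := by
  rw [conv_congr (ae_eq_refl _) (ae_eq_weightedVolume.1 (Lp.coeFn_add g g'))]
  simp only [conv, Pi.add_apply, mul_add]
  exact integral_add (integrable_conv hp f g x) (integrable_conv hp f g' x)

lemma conv_smul_left (c : ℝ) (f g : WeightedL2 p) (x : ℝ × ℝ) :
    conv (c • f : WeightedL2 p) g x = c • conv f g x := by
  rw [conv_congr (ae_eq_weightedVolume.1 (Lp.coeFn_smul c f)) (ae_eq_refl _)]
  simp only [conv, Pi.smul_apply, smul_mul_assoc, integral_smul]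

lemma conv_smul_right (c : ℝ) (f g : WeightedL2 p) (x : ℝ × ℝ) :
    conv f (c • g : WeightedL2 p) x = c • conv f g x := by
  rw [conv_congr (ae_eq_refl _) (ae_eq_weightedVolume.1 (Lp.coeFn_smul c g))]
  simp only [conv, Pi.smul_apply, mul_smul_comm, integral_smul]

/-- Evaluation of a convolution at a point, as a bounded bilinear map. -/
noncomputable def convAt (hp : 1 < p) (x : ℝ × ℝ) :
    WeightedL2 p →L[ℝ] WeightedL2 p →L[ℝ] ℂ :=
  (LinearMap.mk₂ ℝ (fun f g : WeightedL2 p => conv f g x)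
    (fun f f' g => conv_add_left hp f f' g x) (fun c f g => conv_smul_left c f g x)
    (fun f g g' => conv_add_right hp f g g' x)
    (fun c f g => conv_smul_right c f g x)).mkContinuous₂ 1 fun f g => by
      have h := ENNReal.toReal_mono (ENNReal.mul_ne_top (Lp.eLpNorm_ne_top f) (Lp.eLpNorm_ne_top g))
        (enorm_conv_le (by linarith) (measurable_coe f) (measurable_coe g) x)
      simpa [toReal_eLpNorm] using h

@[simp] lemma convAt_apply (hp : 1 < p) (x : ℝ × ℝ) (f g : WeightedL2 p) :
    convAt hp x f g = conv f g x := rfl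

lemma norm_convAt_le (hp : 1 < p) (x : ℝ × ℝ) : ‖convAt hp x‖ ≤ 1 :=
  LinearMap.mkContinuous₂_norm_le _ zero_le_one _

lemma memLp_conv (hp : 1 < p) (f g : WeightedL2 p) : MemLp (conv f g) 2 (weightedVolume p) :=
  _root_.memLp_conv hp (measurable_coe f) (measurable_coe g) (Lp.memLp f) (Lp.memLp g)

/-- Convolution as a bounded bilinear map on the weighted space. -/
noncomputable def convL (hp : 1 < p) : WeightedL2 p →L[ℝ] WeightedL2 p →L[ℝ] WeightedL2 p :=
  (LinearMap.mk₂ ℝ (fun f g : WeightedL2 p => (memLp_conv hp f g).toLp (conv f g))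
    (fun f f' g => by
      rw [← MemLp.toLp_add]
      exact MemLp.toLp_congr _ _ (.of_forall fun x => conv_add_left hp f f' g x))
    (fun c f g => by
      rw [← MemLp.toLp_const_smul]
      exact MemLp.toLp_congr _ _ (.of_forall fun x => conv_smul_left c f g x))
    (fun f g g' => by
      rw [← MemLp.toLp_add]
      exact MemLp.toLp_congr _ _ (.of_forall fun x => conv_add_right hp f g g' x))
    (fun c f g => by
      rw [← MemLp.toLp_const_smul]
      exact MemLp.toLp_congr _ _ (.of_forall fun x => conv_smul_right c f g x))).mkContinuous₂
    (convConst p ^ (1 / 2 : ℝ)).toReal fun f g => by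
      have h := ENNReal.toReal_mono (ENNReal.mul_ne_top
          (ENNReal.rpow_lt_top_of_nonneg (by norm_num) (convConst_lt_top hp).ne).ne
          (ENNReal.mul_ne_top (Lp.eLpNorm_ne_top f) (Lp.eLpNorm_ne_top g)))
        (eLpNorm_conv_le (by linarith) (measurable_coe f) (measurable_coe g))
      rw [ENNReal.toReal_mul, ENNReal.toReal_mul, toReal_eLpNorm, toReal_eLpNorm] at h
      rw [LinearMap.mk₂_apply, Lp.norm_toLp, mul_assoc]
      exact h

lemma convL_ae (hp : 1 < p) (f g : WeightedL2 p) : convL hp f g =ᵐ[volume] conv f g :=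
  ae_eq_weightedVolume.1 (MemLp.coeFn_toLp (memLp_conv hp f g))

lemma measurable_dag {f : ℝ × ℝ → ℂ} (hf : Measurable f) : Measurable (dag f) := by
  unfold dag
  fun_prop

lemma eLpNorm_dag (p : ℝ) (f : ℝ × ℝ → ℂ) :
    eLpNorm (dag f) 2 (weightedVolume p) = eLpNorm f 2 (weightedVolume p) := by
  rw [← (ENNReal.pow_right_strictMono two_ne_zero).injective.eq_iff]
  simp only [sq_eLpNorm_weightedVolume]
  rw [← lintegral_neg_eq_self (fun x => weight p x * ‖f x‖ₑ ^ 2)]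
  simp [dag, weight]

lemma memLp_dag (f : WeightedL2 p) : MemLp (dag f) 2 (weightedVolume p) :=
  ⟨(measurable_dag (measurable_coe f)).aestronglyMeasurable,
    (eLpNorm_dag p f).trans_lt (Lp.eLpNorm_lt_top f)⟩

/-- The involution `dag` as a bounded real-linear map on the weighted space. -/
noncomputable def dagL : WeightedL2 p →L[ℝ] WeightedL2 p :=
  LinearMap.mkContinuous
    { toFun := fun f => (memLp_dag f).toLp (dag f)
      map_add' := fun f g => by
        rw [← MemLp.toLp_add]
        refine MemLp.toLp_congr _ _ (ae_eq_weightedVolume.2 ?_)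
        filter_upwards [dag_congr (ae_eq_weightedVolume.1 (Lp.coeFn_add f g))] with x hx
        rw [hx]
        simp [dag]
      map_smul' := fun c f => by
        rw [RingHom.id_apply, ← MemLp.toLp_const_smul]
        refine MemLp.toLp_congr _ _ (ae_eq_weightedVolume.2 ?_)
        filter_upwards [dag_congr (ae_eq_weightedVolume.1 (Lp.coeFn_smul c f))] with x hx
        rw [hx]
        simp [dag] } 1 fun f => by
      simp [Lp.norm_toLp, eLpNorm_dag, toReal_eLpNorm]

lemma dagL_ae (f : WeightedL2 p) : dagL f =ᵐ[volume] dag f :=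
  ae_eq_weightedVolume.1 (MemLp.coeFn_toLp (memLp_dag f))

lemma eLpNorm_mul_le {m : ℝ × ℝ → ℂ} (hm : ∀ x, ‖m x‖ ≤ 1) (f : ℝ × ℝ → ℂ) :
    eLpNorm (fun x => m x * f x) 2 (weightedVolume p) ≤ eLpNorm f 2 (weightedVolume p) :=
  eLpNorm_mono fun x => by
    rw [norm_mul]
    exact mul_le_of_le_one_left (norm_nonneg _) (hm x)

lemma memLp_mul {m : ℝ × ℝ → ℂ} (hmm : Measurable m) (hm : ∀ x, ‖m x‖ ≤ 1) (f : WeightedL2 p) :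
    MemLp (fun x => m x * f x) 2 (weightedVolume p) :=
  ⟨(hmm.mul (measurable_coe f)).aestronglyMeasurable,
    (eLpNorm_mul_le hm f).trans_lt (Lp.eLpNorm_lt_top f)⟩

/-- Multiplication by a measurable function bounded by `1` on the weighted space. -/
noncomputable def mulL {m : ℝ × ℝ → ℂ} (hmm : Measurable m) (hm : ∀ x, ‖m x‖ ≤ 1) :
    WeightedL2 p →L[ℝ] WeightedL2 p :=
  LinearMap.mkContinuous
    { toFun := fun f => (memLp_mul hmm hm f).toLp _
      map_add' := fun f g => by
        rw [← MemLp.toLp_add]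
        refine MemLp.toLp_congr _ _ ?_
        filter_upwards [Lp.coeFn_add f g] with x hx
        rw [hx]
        simp [mul_add]
      map_smul' := fun c f => by
        rw [RingHom.id_apply, ← MemLp.toLp_const_smul]
        refine MemLp.toLp_congr _ _ ?_
        filter_upwards [Lp.coeFn_smul c f] with x hx
        rw [hx]
        simp [mul_left_comm] } 1 fun f => by
      have h := ENNReal.toReal_mono (Lp.eLpNorm_ne_top f) (eLpNorm_mul_le hm f)
      simpa [Lp.norm_toLp, toReal_eLpNorm] using h

lemma mulL_ae {m : ℝ × ℝ → ℂ} (hmm : Measurable m) (hm : ∀ x, ‖m x‖ ≤ 1) (f : WeightedL2 p) :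
    mulL hmm hm f =ᵐ[volume] fun x => m x * f x :=
  ae_eq_weightedVolume.1 (MemLp.coeFn_toLp (memLp_mul hmm hm f))

/-- The symbol `exp (i (k² - m²) t)` of the free flow. -/
noncomputable def phase (t : ℝ) (x : ℝ × ℝ) : ℂ :=
  Complex.exp (Complex.I * (((x.1 ^ 2 - x.2 ^ 2) * t : ℝ) : ℂ))

lemma norm_phase (t : ℝ) (x : ℝ × ℝ) : ‖phase t x‖ = 1 := by
  rw [phase, mul_comm, Complex.norm_exp_ofReal_mul_I]

lemma continuous_phase : Continuous fun q : ℝ × (ℝ × ℝ) => phase q.1 q.2 := by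
  unfold phase
  fun_prop

lemma measurable_phase (t : ℝ) : Measurable (phase t) :=
  (continuous_phase.comp (Continuous.prodMk_right t)).measurable

lemma phase_add (s t : ℝ) (x : ℝ × ℝ) : phase (s + t) x = phase s x * phase t x := by
  rw [phase, phase, phase, ← Complex.exp_add]
  congr 1
  push_cast
  ring

/-- The free flow on the weighted space. -/
noncomputable def flow (t : ℝ) : WeightedL2 p →L[ℝ] WeightedL2 p :=
  mulL (measurable_phase t) fun x => (norm_phase t x).le

lemma flow_ae (t : ℝ) (f : WeightedL2 p) : flow t f =ᵐ[volume] fun x => phase t x * f x :=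
  mulL_ae _ _ f

lemma norm_flow (t : ℝ) (f : WeightedL2 p) : ‖flow t f‖ = ‖f‖ := by
  rw [Lp.norm_def, Lp.norm_def]
  congr 1
  rw [eLpNorm_congr_ae (ae_eq_weightedVolume.2 (flow_ae t f))]
  exact eLpNorm_congr_norm_ae (.of_forall fun x => by simp [norm_phase])

lemma continuous_flow (f : WeightedL2 p) : Continuous fun t => flow t f := by
  rw [continuous_iff_continuousAt]
  intro s
  rw [ContinuousAt, tendsto_iff_edist_tendsto_0]
  have hE : ∀ t, edist (flow t f) (flow s f) =
      (∫⁻ x, ‖(phase t x - phase s x) * f x‖ₑ ^ 2 ∂(weightedVolume p)) ^ (1 / 2 : ℝ) := by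
    intro t
    rw [Lp.edist_def, eLpNorm_eq_lintegral_rpow_enorm_toReal (by norm_num) (by norm_num)]
    congr 1
    refine lintegral_congr_ae ?_
    filter_upwards [(ae_eq_weightedVolume (p := p)).2 (flow_ae t f),
      (ae_eq_weightedVolume (p := p)).2 (flow_ae s f)] with x h1 h2
    simp [h1, h2, sub_mul]
  simp only [hE]
  have h0 : (0 : ℝ≥0∞) = (∫⁻ _, 0 ∂(weightedVolume p)) ^ (1 / 2 : ℝ) := by simp
  rw [h0]
  refine (ENNReal.continuous_rpow_const.tendsto _).comp ?_
  have hm := measurable_coe f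
  refine tendsto_lintegral_filter_of_dominated_convergence (fun x => 4 * ‖f x‖ₑ ^ 2)
    (.of_forall fun t => ?_) (.of_forall fun t => .of_forall fun x => ?_) ?_
    (.of_forall fun x => ?_)
  · have h1 := measurable_phase t
    have h2 := measurable_phase s
    fun_prop
  · have : ‖phase t x - phase s x‖ₑ ≤ 2 := by
      rw [← ofReal_norm]
      refine ENNReal.ofReal_le_of_le_toReal ?_
      refine (norm_sub_le _ _).trans ?_
      norm_num [norm_phase]
    rw [enorm_mul, mul_pow]
    gcongr
    calc ‖phase t x - phase s x‖ₑ ^ 2 ≤ 2 ^ 2 := by gcongr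
      _ = 4 := by norm_num
  · rw [lintegral_const_mul _ (by fun_prop)]
    refine ENNReal.mul_ne_top (by norm_num) ?_
    have := Lp.eLpNorm_ne_top f
    rw [eLpNorm_eq_lintegral_rpow_enorm_toReal (by norm_num) (by norm_num)] at this
    intro h
    apply this
    simp [h]
  · have hc : Continuous fun t => ‖(phase t x - phase s x) * f x‖ₑ ^ 2 := by
      have h : Continuous fun t => phase t x := continuous_phase.comp (Continuous.prodMk_left x)
      exact (ENNReal.continuous_pow 2).comp ((h.sub continuous_const).mul continuous_const).enorm
    exact hc.tendsto' s 0 (by simp)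

lemma continuous_uncurry_flow :
    Continuous fun q : ℝ × WeightedL2 p => flow q.1 q.2 :=
  continuous_uncurry_of_norm_eq _ norm_flow continuous_flow

lemma continuous_flow_comp {s : ℝ → ℝ} (hs : Continuous s) {f : ℝ → WeightedL2 p}
    (hf : Continuous f) : Continuous fun t => flow (s t) (f t) :=
  Continuous.comp (f := fun t => (s t, f t)) continuous_uncurry_flow (hs.prodMk hf)

end WeightedL2

/-- An `L²`-valued integral of a continuous curve is computed pointwise by the integrals of a
bounded jointly measurable representative. -/
lemma coeFn_intervalIntegral_ae {α : Type*} [MeasurableSpace α] {ν : Measure α} [SigmaFinite ν]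
    {f : ℝ → Lp ℂ 2 ν} (hf : Continuous f) {g : ℝ → α → ℂ} (hfg : ∀ τ, f τ =ᵐ[ν] g τ)
    (hg : Measurable (Function.uncurry g)) {t C : ℝ} (ht : 0 ≤ t)
    (hC : ∀ τ ∈ Set.Ioc 0 t, ∀ x, ‖g τ x‖ ≤ C) :
    (∫ τ in (0 : ℝ)..t, f τ : Lp ℂ 2 ν) =ᵐ[ν] fun x => ∫ τ in (0 : ℝ)..t, g τ x := by
  simp only [intervalIntegral.integral_of_le ht]
  have hfint : Integrable f (volume.restrict (Set.Ioc 0 t)) :=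
    (hf.continuousOn.integrableOn_Icc).mono_set Set.Ioc_subset_Icc_self
  have hprod : ∀ s, ν s < ⊤ → Integrable (Function.uncurry g)
      ((volume.restrict (Set.Ioc 0 t)).prod (ν.restrict s)) := fun s hs => by
    have : IsFiniteMeasure (ν.restrict s) := ⟨by simpa using hs⟩
    refine Integrable.of_bound hg.aestronglyMeasurable C ?_
    have h : ∀ᵐ τ ∂(volume.restrict (Set.Ioc 0 t)), ∀ᵐ x ∂(ν.restrict s), ‖g τ x‖ ≤ C := by
      filter_upwards [ae_restrict_mem measurableSet_Ioc] with τ hτ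
      exact .of_forall (hC τ hτ)
    refine (Measure.ae_prod_iff_ae_ae ?_).2 h
    exact measurableSet_le hg.norm measurable_const
  refine ae_eq_of_forall_setIntegral_eq_of_sigmaFinite
    (fun s hs hνs => integrableOn_Lp_of_measure_ne_top _ fact_one_le_two_ennreal.elim hνs.ne)
    (fun s hs hνs => (hprod s hνs).integral_prod_right) (fun s hs hνs => ?_)
  rw [← integral_integral_swap (hprod s hνs),
    ← L2.inner_indicatorConstLp_one hs hνs.ne, ← integral_inner hfint]
  refine integral_congr_ae (.of_forall fun τ => ?_)
  simp only [L2.inner_indicatorConstLp_one hs hνs.ne]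
  exact integral_congr_ae (ae_restrict_of_ae (hfg τ))

lemma Lop_congr (γ lam μ : ℝ) {f g : ℝ × ℝ → ℂ} (h : f =ᵐ[volume] g) :
    Lop γ lam μ f = Lop γ lam μ g := by
  have h1 : conv f (dag f) = conv g (dag g) := conv_congr h (dag_congr h)
  funext x
  rw [Lop, Lop, h1, conv_congr (ae_eq_refl _) h, conv_congr h (ae_eq_refl _)]

lemma measurable_sigmaMul : Measurable fun x => (sigmaMul x : ℂ) := by
  unfold sigmaMul
  refine Complex.measurable_ofReal.comp (Measurable.ite (measurableSet_singleton 0) ?_ ?_) <;>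
  fun_prop

lemma norm_sigmaMul_le (x : ℝ × ℝ) : ‖(sigmaMul x : ℂ)‖ ≤ 1 := by
  rw [Complex.norm_real, sigmaMul]
  split_ifs
  · simp
  · rw [Real.norm_of_nonneg (by positivity)]
    exact div_le_one_of_le₀ (by linarith [sq_nonneg x.2]) (by positivity)

namespace WeightedL2

variable {p : ℝ}

/-- The quadratic expression `v ⋆ v†` on the weighted space. -/
noncomputable def selfConv (hp : 1 < p) (f : WeightedL2 p) : WeightedL2 p := convL hp f (dagL f)

/-- The operator `v ↦ σ v` on the weighted space. -/
noncomputable def sigmaL : WeightedL2 p →L[ℝ] WeightedL2 p :=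
  mulL measurable_sigmaMul norm_sigmaMul_le

/-- The values of the Davey–Stewartson nonlinearity, in terms of bounded multilinear maps. -/
noncomputable def nonlinAt (hp : 1 < p) (γ lam μ : ℝ) (x : ℝ × ℝ) (f : WeightedL2 p) : ℂ :=
  γ • convAt hp x (selfConv hp f) f + (lam * μ) • convAt hp x f (sigmaL (selfConv hp f))

/-- The Davey–Stewartson nonlinearity on the weighted space. -/
noncomputable def nonlin (hp : 1 < p) (γ lam μ : ℝ) (f : WeightedL2 p) : WeightedL2 p :=
  γ • convL hp (selfConv hp f) f + (lam * μ) • convL hp f (sigmaL (selfConv hp f))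

lemma selfConv_ae (hp : 1 < p) (f : WeightedL2 p) :
    selfConv hp f =ᵐ[volume] conv f (dag f) :=
  (convL_ae hp f (dagL f)).trans (by rw [conv_congr (ae_eq_refl _) (dagL_ae f)])

lemma nonlinAt_eq (hp : 1 < p) (γ lam μ : ℝ) (x : ℝ × ℝ) (f : WeightedL2 p) :
    nonlinAt hp γ lam μ x f = Lop γ lam μ f x := by
  have h : sigmaL (selfConv hp f) =ᵐ[volume] fun y => (sigmaMul y : ℂ) * conv f (dag f) y := by
    filter_upwards [mulL_ae measurable_sigmaMul norm_sigmaMul_le (selfConv hp f),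
      selfConv_ae hp f] with y h1 h2
    rw [sigmaL, h1, h2]
  rw [nonlinAt, convAt_apply, convAt_apply, conv_congr (selfConv_ae hp f) (ae_eq_refl _),
    conv_congr (ae_eq_refl _) h, Lop, Complex.real_smul, Complex.real_smul]

lemma nonlin_ae (hp : 1 < p) (γ lam μ : ℝ) (f : WeightedL2 p) :
    nonlin hp γ lam μ f =ᵐ[volume] Lop γ lam μ f := by
  filter_upwards [ae_eq_weightedVolume.1 (Lp.coeFn_add (γ • convL hp (selfConv hp f) f)
      ((lam * μ) • convL hp f (sigmaL (selfConv hp f)))),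
    ae_eq_weightedVolume.1 (Lp.coeFn_smul γ (convL hp (selfConv hp f) f)),
    ae_eq_weightedVolume.1 (Lp.coeFn_smul (lam * μ) (convL hp f (sigmaL (selfConv hp f)))),
    convL_ae hp (selfConv hp f) f, convL_ae hp f (sigmaL (selfConv hp f))] with x h1 h2 h3 h4 h5
  rw [nonlin, h1, Pi.add_apply, h2, h3, Pi.smul_apply, Pi.smul_apply, h4, h5, ← nonlinAt_eq hp]
  rfl

lemma lipschitzOnBalls_selfConv (hp : 1 < p) :
    LipschitzOnBalls (selfConv hp : WeightedL2 p → WeightedL2 p) :=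
  lipschitzOnBalls_id.bilin (lipschitzOnBalls_id.clm_comp dagL) (convL hp)

lemma lipschitzOnBalls_nonlin (hp : 1 < p) (γ lam μ : ℝ) :
    LipschitzOnBalls (nonlin hp γ lam μ) :=
  have h := lipschitzOnBalls_selfConv hp
  ((h.bilin lipschitzOnBalls_id (convL hp)).const_smul γ).add
    ((lipschitzOnBalls_id.bilin (h.clm_comp sigmaL) (convL hp)).const_smul (lam * μ))

lemma continuous_nonlinAt (hp : 1 < p) (γ lam μ : ℝ) (x : ℝ × ℝ) :
    Continuous (nonlinAt hp γ lam μ x) :=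
  have h := lipschitzOnBalls_selfConv hp
  (((h.bilin lipschitzOnBalls_id (convAt hp x)).const_smul γ).add
    ((lipschitzOnBalls_id.bilin (h.clm_comp sigmaL) (convAt hp x)).const_smul
      (lam * μ))).continuous

lemma exists_norm_nonlinAt_le (hp : 1 < p) (γ lam μ R : ℝ) :
    ∃ C : ℝ, ∀ f : WeightedL2 p, ‖f‖ ≤ R → ∀ x, ‖nonlinAt hp γ lam μ x f‖ ≤ C := by
  obtain ⟨M, hM⟩ := (lipschitzOnBalls_selfConv hp).exists_bound R
  obtain ⟨M', hM'⟩ := ((lipschitzOnBalls_selfConv hp).clm_comp sigmaL).exists_bound R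
  have hconv : ∀ x (a b : WeightedL2 p), ‖convAt hp x a b‖ ≤ ‖a‖ * ‖b‖ := fun x a b =>
    ((convAt hp x).le_opNorm₂ a b).trans (by
      rw [mul_assoc]
      exact mul_le_of_le_one_left (by positivity) (norm_convAt_le hp x))
  refine ⟨|γ| * (M * R) + |lam * μ| * (R * M'), fun f hf x => ?_⟩
  have hR : 0 ≤ R := (norm_nonneg f).trans hf
  refine (norm_add_le _ _).trans ?_
  rw [norm_smul, norm_smul, Real.norm_eq_abs, Real.norm_eq_abs]
  gcongr
  · exact (hconv _ _ _).trans (by gcongr; exact hM f hf)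
  · exact (hconv _ _ _).trans (by gcongr; exact hM' f hf)

lemma measurable_nonlinAt (hp : 1 < p) (γ lam μ : ℝ) (f : WeightedL2 p) :
    Measurable fun x => nonlinAt hp γ lam μ x f := by
  have h1 := measurable_conv (measurable_coe (selfConv hp f)) (measurable_coe f)
  have h2 := measurable_conv (measurable_coe f) (measurable_coe (sigmaL (selfConv hp f)))
  exact (h1.const_smul γ).add (h2.const_smul (lam * μ))

end WeightedL2

namespace WeightedL2

variable {p : ℝ}

/-- Multiplication by `-i` on the weighted space. -/
noncomputable def negI : WeightedL2 p →L[ℝ] WeightedL2 p :=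
  mulL (m := fun _ => -Complex.I) measurable_const fun _ => by simp

lemma Lop_flow_phase2 (hp : 1 < p) (γ lam μ τ : ℝ) (f : WeightedL2 p) (x : ℝ × ℝ) :
    Lop γ lam μ (fun y => flow (-τ) f y * phase2 τ y) x =
      nonlinAt hp γ lam μ x (flow τ f) := by
  rw [nonlinAt_eq]
  refine congrFun (Lop_congr γ lam μ ?_) x
  filter_upwards [flow_ae (-τ) f, flow_ae τ f] with y h1 h2
  have h : phase2 τ y = phase (τ + τ) y := by
    rw [phase2, phase]
    congr 1
    push_cast
    ring
  rw [h1, h2, h, mul_right_comm, ← phase_add, neg_add_cancel_left]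

/-- The mild equation in the interaction picture, read off pointwise. -/
lemma integral_flow_nonlin_ae (hp : 1 < p) (γ lam μ : ℝ) {w : ℝ → WeightedL2 p}
    (hw : Continuous w) {t : ℝ} (ht : 0 ≤ t) :
    (∫ τ in (0 : ℝ)..t, flow τ (negI (nonlin hp γ lam μ (flow τ (w τ)))) : WeightedL2 p)
      =ᵐ[volume] fun x => ∫ τ in (0 : ℝ)..t,
        phase τ x * (-Complex.I * nonlinAt hp γ lam μ x (flow τ (w τ))) := by
  have hfw : Continuous fun τ => flow τ (w τ) := continuous_flow_comp continuous_id' hw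
  have hN : Continuous fun τ => negI (nonlin hp γ lam μ (flow τ (w τ))) :=
    negI.continuous.comp ((lipschitzOnBalls_nonlin hp γ lam μ).continuous.comp hfw)
  obtain ⟨R, hR⟩ := (isCompact_Icc (a := (0 : ℝ)) (b := t)).exists_bound_of_continuousOn
    hfw.continuousOn
  obtain ⟨C, hC⟩ := exists_norm_nonlinAt_le hp γ lam μ R
  refine ae_eq_weightedVolume.1 (coeFn_intervalIntegral_ae (C := C)
    (continuous_flow_comp continuous_id' hN) (fun τ => ?_) ?_ ht fun τ hτ x => ?_)
  · refine ae_eq_weightedVolume.2 ?_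
    filter_upwards [flow_ae τ (negI (nonlin hp γ lam μ (flow τ (w τ)))),
      mulL_ae (m := fun _ => -Complex.I) measurable_const (fun _ => by simp)
        (nonlin hp γ lam μ (flow τ (w τ))), nonlin_ae hp γ lam μ (flow τ (w τ))] with x h1 h2 h3
    rw [h1, negI, h2, h3, nonlinAt_eq]
  · refine measurable_uncurry_of_continuous_of_measurable (fun x => ?_) fun τ => ?_
    · have h : Continuous fun τ => phase τ x := continuous_phase.comp (Continuous.prodMk_left x)
      exact h.mul (continuous_const.mul ((continuous_nonlinAt hp γ lam μ x).comp hfw))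
    · exact (measurable_phase τ).mul (measurable_const.mul (measurable_nonlinAt hp γ lam μ _))
  · rw [norm_mul, norm_mul, norm_phase, norm_neg, Complex.norm_I, one_mul, one_mul]
    exact hC _ (hR τ (Set.Ioc_subset_Icc_self hτ)) x

lemma contCurve_coeFn {f : ℝ → WeightedL2 p} (hf : Continuous f) (T : ℝ) :
    ContCurve p T fun t => f t := by
  refine ⟨fun t _ => measurable_coe _, fun t₀ _ => ?_⟩
  simp only [← eLpNorm_weightedVolume, ← Lp.edist_def]
  exact (tendsto_iff_edist_tendsto_0.1 (hf.tendsto t₀)).mono_left nhdsWithin_le_nhds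

end WeightedL2

open WeightedL2

/-- **Existence of a mild solution of the Fourier-transformed Davey–Stewartson-II
system.** For `p > 1` and measurable `û₀` with `‖û₀‖_p < ∞`, there exist `T > 0` and a
continuous curve `v : [0,T] → X_p` with `v(0) = û₀` satisfying the Duhamel integral
equation for all `t ∈ [0,T]` and a.e. `(k,m)`. -/
theorem ds_mild_existence (p : ℝ) (hp : 1 < p) (γ lam μ : ℝ)
    (u0 : ℝ × ℝ → ℂ) (hu0 : Measurable u0) (hfin : wnorm p u0 < ⊤) :
    ∃ T : ℝ, 0 < T ∧ ∃ v : ℝ → ℝ × ℝ → ℂ,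
      ContCurve p T v ∧
      (∀ t ∈ Set.Icc (0 : ℝ) T, wnorm p (v t) < ⊤) ∧
      (∀ᵐ km : ℝ × ℝ, v 0 km = u0 km) ∧
      ∀ t ∈ Set.Icc (0 : ℝ) T, ∀ᵐ km : ℝ × ℝ, v t km = duhamel γ lam μ u0 v t km := by
  have hmem : MemLp u0 2 (weightedVolume p) :=
    ⟨hu0.aestronglyMeasurable, (eLpNorm_weightedVolume p u0).trans_lt hfin⟩
  have hU0 := ae_eq_weightedVolume.1 hmem.coeFn_toLp
  obtain ⟨T, hT, w, hw, hw0, hint⟩ := exists_continuous_eq_integral (flow (p := p)) norm_flow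
    continuous_flow ((lipschitzOnBalls_nonlin hp γ lam μ).clm_comp negI) (hmem.toLp u0)
  refine ⟨T, hT, fun t => flow (-t) (w t), contCurve_coeFn
    (continuous_flow_comp continuous_neg hw) T, fun t _ => ?_, ?_,
    fun t ht => ?_⟩
  · rw [← eLpNorm_weightedVolume]
    exact Lp.eLpNorm_lt_top _
  · filter_upwards [flow_ae (-0) (w 0), hU0] with x h1 h2
    rw [h1, hw0, h2]
    simp [phase]
  · filter_upwards [flow_ae (-t) (w t), hU0, ae_eq_weightedVolume.1 (Lp.coeFn_add (hmem.toLp u0)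
      (∫ τ in (0 : ℝ)..t, flow τ (negI (nonlin hp γ lam μ (flow τ (w τ)))))),
      integral_flow_nonlin_ae hp γ lam μ hw ht.1] with x h1 h2 h3 h4
    have hint' : ∫ τ in (0 : ℝ)..t, Complex.exp
          (Complex.I * (((x.1 ^ 2 - x.2 ^ 2) * (τ - t) : ℝ) : ℂ)) *
            Lop γ lam μ (fun y => flow (-τ) (w τ) y * phase2 τ y) x =
        phase (-t) x * ∫ τ in (0 : ℝ)..t,
          phase τ x * nonlinAt hp γ lam μ x (flow τ (w τ)) := by
      rw [← intervalIntegral.integral_const_mul]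
      refine intervalIntegral.integral_congr fun τ _ => ?_
      change phase (τ - t) x * _ = _
      rw [Lop_flow_phase2 hp, sub_eq_neg_add, phase_add, mul_assoc]
    have hphase : Complex.exp (Complex.I * (((x.2 ^ 2 - x.1 ^ 2) * t : ℝ) : ℂ)) =
        phase (-t) x := by
      rw [phase]
      congr 3
      ring
    rw [duhamel, hint', hphase, h1, hint t ht, h3, Pi.add_apply, h2, h4]
    simp only [mul_left_comm _ (-Complex.I), intervalIntegral.integral_const_mul]
    ring
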